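/- Let C_th be the unique positive solution of ln(1+x) - 3 + 3/(1+x) = 0. If 0 < γ₀ ≤ C_th, then for every real K ≥ 1 it holds that K · ln(1 + γ₀/K³) ≤ ln(1 + γ₀). (In other words, under this condition the sum-rate of the distributed IRS, K·log₂(1+γ₀/K³), never exceeds the sum-rate log₂(1+γ₀) of the centralized IRS.) -/

import Mathlib

/-- `g x = ln (1 + x) - 3 + 3 / (1 + x)`. -/
noncomputable def g (x : ℝ) : ℝ := Real.log (1 + x) - 3 + 3 / (1 + x)

lemma g_hasDerivAt (x : ℝ) (hx : 0 ≤ x) : HasDerivAt g ((x - 2) / (1 + x) ^ 2) x := by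
  have h0 : (1 + x) ≠ 0 := by positivity
  have h1 : HasDerivAt (fun y : ℝ => 1 + y) 1 x := (hasDerivAt_id x).const_add 1
  have h2 := ((h1.log h0).sub_const 3).add ((hasDerivAt_const x (3 : ℝ)).div h1 h0)
  have h3 : HasDerivAt g _ x := h2
  convert h3 using 1
  field_simp
  ring

lemma g_nonpos (C x : ℝ) (hC : g C = 0) (hx : 0 ≤ x) (hxC : x ≤ C) : g x ≤ 0 := by
  rcases le_total x 2 with h | h
  · have ha : AntitoneOn g (Set.Icc 0 2) := by
      apply antitoneOn_of_deriv_nonpos (convex_Icc 0 2)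
      · intro y hy
        exact (g_hasDerivAt y hy.1).continuousAt.continuousWithinAt
      · intro y hy
        rw [interior_Icc] at hy
        exact (g_hasDerivAt y hy.1.le).differentiableAt.differentiableWithinAt
      · intro y hy
        rw [interior_Icc] at hy
        rw [(g_hasDerivAt y hy.1.le).deriv]
        exact div_nonpos_of_nonpos_of_nonneg (by linarith [hy.2]) (by positivity)
    have h0 : g 0 = 0 := by simp [g]
    rw [← h0]
    exact ha ⟨le_refl _, by norm_num⟩ ⟨hx, h⟩ hx
  · have ha : MonotoneOn g (Set.Ici 2) := by
      apply monotoneOn_of_deriv_nonneg (convex_Ici 2)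
      · intro y hy
        have hy' : (2 : ℝ) ≤ y := hy
        exact (g_hasDerivAt y (by linarith)).continuousAt.continuousWithinAt
      · intro y hy
        rw [interior_Ici] at hy
        have hy' : (2 : ℝ) < y := hy
        exact (g_hasDerivAt y (by linarith)).differentiableAt.differentiableWithinAt
      · intro y hy
        rw [interior_Ici] at hy
        have hy' : (2 : ℝ) < y := hy
        rw [(g_hasDerivAt y (by linarith)).deriv]
        exact div_nonneg (by linarith) (by positivity)
    rw [← hC]
    exact ha h (h.trans hxC) hxC

lemma rate_hasDerivAt (c K : ℝ) (hc : 0 < c) (hK : 0 < K) :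
    HasDerivAt (fun K : ℝ => K * Real.log (1 + c / K ^ 3)) (g (c / K ^ 3)) K := by
  have hK3 : K ^ 3 ≠ 0 := by positivity
  have h0 : 1 + c / K ^ 3 ≠ 0 := by positivity
  have h1 : HasDerivAt (fun y : ℝ => 1 + c / y ^ 3) _ K :=
    ((hasDerivAt_const K c).div (hasDerivAt_pow 3 K) hK3).const_add 1
  have h2 := (hasDerivAt_id K).mul (h1.log h0)
  have h3 : HasDerivAt (fun K : ℝ => K * Real.log (1 + c / K ^ 3)) _ K := h2
  convert h3 using 1
  have h4 : K ^ 3 + c ≠ 0 := by positivity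
  simp only [g, id]
  field_simp
  push_cast
  ring

/-- Let `Cth` be the unique positive solution of `g x = 0`. If `0 < γ₀ ≤ Cth`, then for
every real `K ≥ 1`, `K * ln (1 + γ₀ / K ^ 3) ≤ ln (1 + γ₀)`. -/
theorem stmt_4 (Cth : ℝ) (hCth_pos : 0 < Cth) (hCth_root : g Cth = 0)
    (hCth_uniq : ∀ x : ℝ, 0 < x → g x = 0 → x = Cth)
    (γ₀ : ℝ) (hγ₀_pos : 0 < γ₀) (hγ₀_le : γ₀ ≤ Cth) :
    ∀ K : ℝ, 1 ≤ K → K * Real.log (1 + γ₀ / K ^ 3) ≤ Real.log (1 + γ₀) := by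
  intro K hK
  have ha : AntitoneOn (fun K : ℝ => K * Real.log (1 + γ₀ / K ^ 3)) (Set.Ici 1) := by
    apply antitoneOn_of_deriv_nonpos (convex_Ici 1)
    · intro y hy
      have hy' : (1 : ℝ) ≤ y := hy
      exact (rate_hasDerivAt γ₀ y hγ₀_pos (by linarith)).continuousAt.continuousWithinAt
    · intro y hy
      rw [interior_Ici] at hy
      have hy' : (1 : ℝ) < y := hy
      exact (rate_hasDerivAt γ₀ y hγ₀_pos (by linarith)).differentiableAt.differentiableWithinAt
    · intro y hy
      rw [interior_Ici] at hy
      have hy' : (1 : ℝ) < y := hy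
      have hy0 : (0 : ℝ) < y := by linarith
      rw [(rate_hasDerivAt γ₀ y hγ₀_pos hy0).deriv]
      apply g_nonpos Cth _ hCth_root (by positivity)
      exact (div_le_self hγ₀_pos.le (one_le_pow₀ hy'.le)).trans hγ₀_le
  have h := ha (Set.mem_Ici.2 le_rfl) (Set.mem_Ici.2 hK) hK
  simpa using h
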